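/- The function C(d) is uniformly continuous on [0,1]: for every β > 0 there exists α > 0 such that for all d₁, d₂ ∈ [0,1], |d₁ − d₂| < α implies |C(d₁) − C(d₂)| < β. -/

import Mathlib

open scoped BigOperators

noncomputable section

/-- Output alphabet of the binary deletion channel with `n` input bits:
a length `k ≤ n` together with a binary string of that length. -/
abbrev DelOut (n : ℕ) := Σ k : Fin (n + 1), (Fin (k : ℕ) → Bool)

/-- The subsequence of `x` indexed by `S` (taken in increasing order),
as an element of `DelOut n`. -/
def restrictSub {n : ℕ} (x : Fin n → Bool) (S : Finset (Fin n)) : DelOut n :=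
  ⟨⟨S.card, Nat.lt_succ_of_le (by simpa using Finset.card_le_univ S)⟩,
   fun i => x (S.orderEmbOfFin rfl i)⟩

/-- Transition probability of the binary deletion channel `W_n^d`: each input bit is
deleted independently with probability `d`. -/
def delW {n : ℕ} (d : ℝ) (x : Fin n → Bool) (y : DelOut n) : ℝ :=
  ∑ S : Finset (Fin n),
    if restrictSub x S = y then (1 - d) ^ S.card * d ^ (n - S.card) else 0

/-- Transition probability of the exact deletion channel `W_{n,k}`, which keeps exactly `k`
of the `n` input bits, the kept positions being a uniformly random `k`-subset; `k`-subsets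
are identified with strictly monotone maps `Fin k → Fin n`. -/
def exactW {n k : ℕ} (x : Fin n → Bool) (y : Fin k → Bool) : ℝ :=
  ((Finset.univ.filter fun f : Fin k → Fin n => StrictMono f ∧ x ∘ f = y).card : ℝ) /
    (n.choose k : ℝ)

/-- `p` is a probability distribution on the finite alphabet `α`. -/
def IsDist {α : Type*} [Fintype α] (p : α → ℝ) : Prop :=
  (∀ a, 0 ≤ p a) ∧ ∑ a, p a = 1

/-- Base-2 mutual information `I(X;Y)` between the input `X ~ p` and the output `Y`
of the channel with transition matrix `W`. -/
def mutualInfo {α β : Type*} [Fintype α] [Fintype β] (p : α → ℝ) (W : α → β → ℝ) : ℝ :=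
  ∑ x, ∑ y, p x * W x y * Real.logb 2 (W x y / ∑ x', p x' * W x' y)

/-- `C_n(d) = (1/n) · sup_p I(X ; W_n^d(X))`. -/
def Cn (n : ℕ) (d : ℝ) : ℝ :=
  (1 / (n : ℝ)) * ⨆ p : {p : (Fin n → Bool) → ℝ // IsDist p}, mutualInfo p.1 (delW d)

/-- `C_{n,k} = (1/n) · sup_p I(X ; W_{n,k}(X))`. -/
def Cnk (n k : ℕ) : ℝ :=
  (1 / (n : ℝ)) * ⨆ p : {p : (Fin n → Bool) → ℝ // IsDist p},
    mutualInfo p.1 (exactW (n := n) (k := k))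

/-- Capacity of the binary deletion channel: `C(d) = inf_{n ≥ 1} C_n(d)`. -/
def C (d : ℝ) : ℝ := ⨅ n : {m : ℕ // 1 ≤ m}, Cn n d

/-- If the outputs of two channels `W` and `V` admit a coupling `J`, and `f y z` is a family of
subprobability weights describing `y` given `z`, then the mutual informations differ by at most
the expected code length `-log₂ f`. -/
theorem mutualInfo_le_add_of_coupling {α β γ : Type*} [Fintype α] [Fintype β] [Fintype γ]
    {p : α → ℝ} (hp : IsDist p) {W : α → β → ℝ} {V : α → γ → ℝ} {J : α → β → γ → ℝ}
    {f : β → γ → ℝ} {K : ℝ}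
    (hJ : ∀ x y z, 0 ≤ J x y z) (hJW : ∀ x y, ∑ z, J x y z = W x y)
    (hJV : ∀ x z, ∑ y, J x y z = V x z) (hV : ∀ x, ∑ z, V x z = 1)
    (hf : ∀ y z, 0 ≤ f y z) (hfsum : ∀ z, ∑ y, f y z ≤ 1)
    (hfJ : ∀ x y z, J x y z ≠ 0 → f y z ≠ 0)
    (hK : ∀ x, ∑ y, ∑ z, J x y z * -Real.logb 2 (f y z) ≤ K) :
    mutualInfo p W ≤ mutualInfo p V + K := by
  classical
  set qW : β → ℝ := fun y => ∑ x, p x * W x y with hqW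
  set qV : γ → ℝ := fun z => ∑ x, p x * V x z with hqV
  have hW0 : ∀ x y, 0 ≤ W x y := fun x y => hJW x y ▸ Finset.sum_nonneg fun z _ => hJ x y z
  have hV0 : ∀ x z, 0 ≤ V x z := fun x z => hJV x z ▸ Finset.sum_nonneg fun y _ => hJ x y z
  have hqW0 : ∀ y, 0 ≤ qW y := fun y =>
    Finset.sum_nonneg fun x _ => mul_nonneg (hp.1 x) (hW0 x y)
  have hqV0 : ∀ z, 0 ≤ qV z := fun z =>
    Finset.sum_nonneg fun x _ => mul_nonneg (hp.1 x) (hV0 x z)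
  have hlog2 : 0 < Real.log 2 := Real.log_pos one_lt_two
  have hterm : ∀ x y z, p x * J x y z *
      (Real.logb 2 (W x y / qW y) - Real.logb 2 (V x z / qV z) + Real.logb 2 (f y z)) ≤
      (p x * W x y / qW y * (qV z * f y z) - p x * J x y z) / Real.log 2 := by
    intro x y z
    have hrhs : 0 ≤ p x * W x y / qW y * (qV z * f y z) :=
      mul_nonneg (div_nonneg (mul_nonneg (hp.1 x) (hW0 x y)) (hqW0 y))
        (mul_nonneg (hqV0 z) (hf y z))
    rcases eq_or_ne (p x * J x y z) 0 with h0 | h0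
    · rw [h0, zero_mul, sub_zero]; exact div_nonneg hrhs hlog2.le
    have hpx : 0 < p x := (hp.1 x).lt_of_ne' (left_ne_zero_of_mul h0)
    have hJx : 0 < J x y z := (hJ x y z).lt_of_ne' (right_ne_zero_of_mul h0)
    have hJleW : J x y z ≤ W x y := hJW x y ▸
      Finset.single_le_sum (f := fun z => J x y z) (fun z _ => hJ x y z) (Finset.mem_univ z)
    have hJleV : J x y z ≤ V x z := hJV x z ▸
      Finset.single_le_sum (f := fun y => J x y z) (fun y _ => hJ x y z) (Finset.mem_univ y)
    have hWx : 0 < W x y := hJx.trans_le hJleW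
    have hVx : 0 < V x z := hJx.trans_le hJleV
    have hqWy : 0 < qW y := (mul_pos hpx hWx).trans_le
      (Finset.single_le_sum (f := fun x => p x * W x y)
        (fun x _ => mul_nonneg (hp.1 x) (hW0 x y)) (Finset.mem_univ x))
    have hqVz : 0 < qV z := (mul_pos hpx hVx).trans_le
      (Finset.single_le_sum (f := fun x => p x * V x z)
        (fun x _ => mul_nonneg (hp.1 x) (hV0 x z)) (Finset.mem_univ x))
    have hfy : 0 < f y z := (hf y z).lt_of_ne' (hfJ x y z hJx.ne')
    have hlog : Real.log (W x y / qW y) - Real.log (V x z / qV z) + Real.log (f y z) ≤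
        W x y / qW y * (qV z * f y z) / J x y z - 1 := by
      refine le_trans ?_ (Real.log_le_sub_one_of_pos (by positivity))
      rw [Real.log_div (by positivity) hJx.ne', Real.log_mul (by positivity) (by positivity),
        Real.log_mul hqVz.ne' hfy.ne', Real.log_div hVx.ne' hqVz.ne']
      linarith [Real.log_le_log hJx hJleV]
    have := mul_le_mul_of_nonneg_left hlog (mul_pos hpx hJx).le
    simp only [Real.logb, ← sub_div, ← add_div]
    rw [mul_div_assoc']
    refine div_le_div_of_nonneg_right (this.trans_eq ?_) hlog2.le
    field_simp
  have hpJ : ∑ x, ∑ y, ∑ z, p x * J x y z = 1 := by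
    rw [← hp.2]
    refine Finset.sum_congr rfl fun x _ => ?_
    rw [Finset.sum_comm]
    simp only [← Finset.mul_sum, hJV, hV, mul_one]
  have hq : ∑ x, ∑ y, ∑ z, p x * W x y / qW y * (qV z * f y z) ≤ 1 := by
    calc ∑ x, ∑ y, ∑ z, p x * W x y / qW y * (qV z * f y z)
        = ∑ y, ∑ x, ∑ z, p x * W x y / qW y * (qV z * f y z) := Finset.sum_comm
      _ = ∑ y, qW y / qW y * ∑ z, qV z * f y z := by
          refine Finset.sum_congr rfl fun y _ => ?_
          simp only [← Finset.mul_sum, ← Finset.sum_mul, ← Finset.sum_div, hqW]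
      _ ≤ ∑ y, ∑ z, qV z * f y z := by
          refine Finset.sum_le_sum fun y _ => ?_
          exact mul_le_of_le_one_left
            (Finset.sum_nonneg fun z _ => mul_nonneg (hqV0 z) (hf y z)) (div_self_le_one _)
      _ = ∑ z, qV z * ∑ y, f y z := by
          rw [Finset.sum_comm]; simp only [Finset.mul_sum]
      _ ≤ ∑ z, qV z := Finset.sum_le_sum fun z _ => mul_le_of_le_one_right (hqV0 z) (hfsum z)
      _ = 1 := by
          rw [hqV, Finset.sum_comm, ← hp.2]
          simp only [← Finset.mul_sum, hV, mul_one]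
  have hW' : mutualInfo p W = ∑ x, ∑ y, ∑ z, p x * J x y z * Real.logb 2 (W x y / qW y) := by
    simp only [mutualInfo, ← Finset.sum_mul, ← Finset.mul_sum, hJW, hqW]
  have hV' : mutualInfo p V = ∑ x, ∑ y, ∑ z, p x * J x y z * Real.logb 2 (V x z / qV z) := by
    refine Finset.sum_congr rfl fun x _ => ?_
    rw [Finset.sum_comm]
    simp only [← Finset.sum_mul, ← Finset.mul_sum, hJV, hqV]
  have hK' : ∑ x, ∑ y, ∑ z, p x * J x y z * -Real.logb 2 (f y z) ≤ K := by
    calc ∑ x, ∑ y, ∑ z, p x * J x y z * -Real.logb 2 (f y z)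
        = ∑ x, p x * ∑ y, ∑ z, J x y z * -Real.logb 2 (f y z) := by
          simp only [Finset.mul_sum, mul_assoc]
      _ ≤ ∑ x, p x * K := Finset.sum_le_sum fun x _ => mul_le_mul_of_nonneg_left (hK x) (hp.1 x)
      _ = K := by rw [← Finset.sum_mul, hp.2, one_mul]
  have hsum : ∑ x, ∑ y, ∑ z, p x * J x y z *
      (Real.logb 2 (W x y / qW y) - Real.logb 2 (V x z / qV z) + Real.logb 2 (f y z)) ≤ 0 := by
    refine (Finset.sum_le_sum fun x _ => Finset.sum_le_sum fun y _ =>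
      Finset.sum_le_sum fun z _ => hterm x y z).trans ?_
    simp only [← Finset.sum_div, Finset.sum_sub_distrib]
    exact div_nonpos_of_nonpos_of_nonneg (by linarith) hlog2.le
  simp only [mul_add, mul_sub, Finset.sum_add_distrib, Finset.sum_sub_distrib, mul_neg,
    Finset.sum_neg_distrib] at hsum hK'
  linarith

theorem mutualInfo_le_card_div_log_two {α β : Type*} [Fintype α] [Fintype β] {p : α → ℝ}
    (hp : ∀ a, 0 ≤ p a) {W : α → β → ℝ} (hW : ∀ x y, 0 ≤ W x y) (hW1 : ∀ x, ∑ y, W x y = 1) :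
    mutualInfo p W ≤ Fintype.card α / Real.log 2 := by
  have hlog2 : 0 < Real.log 2 := Real.log_pos one_lt_two
  have hq : ∀ x y, p x * W x y ≤ ∑ x', p x' * W x' y := fun x y =>
    Finset.single_le_sum (f := fun x => p x * W x y)
      (fun x _ => mul_nonneg (hp x) (hW x y)) (Finset.mem_univ x)
  calc mutualInfo p W ≤ ∑ x, ∑ y, W x y / Real.log 2 := by
        refine Finset.sum_le_sum fun x _ => Finset.sum_le_sum fun y _ => ?_
        have h0 := mul_nonneg (hp x) (hW x y)
        have hq0 := h0.trans (hq x y)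
        rw [Real.logb, mul_div_assoc']
        refine div_le_div_of_nonneg_right ?_ hlog2.le
        calc p x * W x y * Real.log (W x y / ∑ x', p x' * W x' y)
            ≤ p x * W x y * (W x y / ∑ x', p x' * W x' y) :=
              mul_le_mul_of_nonneg_left (Real.log_le_self (div_nonneg (hW x y) hq0)) h0
          _ = p x * W x y / (∑ x', p x' * W x' y) * W x y := by ring
          _ ≤ W x y := mul_le_of_le_one_left (hW x y) (div_le_one_of_le₀ (hq x y) hq0)
    _ = Fintype.card α / Real.log 2 := by
        simp only [← Finset.sum_div, hW1, Finset.sum_const, Finset.card_univ, nsmul_one]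

theorem mutualInfo_pi_single {α β : Type*} [Fintype α] [DecidableEq α] [Fintype β] (a : α)
    (W : α → β → ℝ) : mutualInfo (Pi.single a 1) W = 0 := by
  refine Finset.sum_eq_zero fun x _ => Finset.sum_eq_zero fun y _ => ?_
  rcases eq_or_ne x a with rfl | h
  · rcases eq_or_ne (W x y) 0 with h0 | h0
    · simp [h0]
    · simp [Pi.single_apply, h0]
  · simp [h]

theorem isDist_pi_single {α : Type*} [Fintype α] [DecidableEq α] (a : α) :
    IsDist (Pi.single a (1 : ℝ)) :=
  ⟨fun b => by rw [Pi.single_apply]; split_ifs <;> norm_num, by simp⟩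

/-- The output string as a list. -/
def DelOut.toList {n : ℕ} (y : DelOut n) : List Bool := List.ofFn y.2

theorem DelOut.toList_injective {n : ℕ} :
    Function.Injective (DelOut.toList : DelOut n → List Bool) := by
  rintro ⟨⟨k, hk⟩, v⟩ ⟨⟨l, hl⟩, w⟩ h
  obtain rfl : k = l := by simpa [DelOut.toList] using congrArg List.length h
  obtain rfl : v = w := List.ofFn_injective h
  rfl

theorem DelOut.length_toList_le {n : ℕ} (y : DelOut n) : y.toList.length ≤ n := by
  simpa [DelOut.toList] using Nat.le_of_lt_succ y.1.2

theorem toList_restrictSub {n : ℕ} (x : Fin n → Bool) (S : Finset (Fin n)) :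
    (restrictSub x S).toList = S.sort.map x := by
  rw [← S.listMap_orderEmbOfFin_finRange rfl, List.map_map, DelOut.toList, List.ofFn_eq_map]
  rfl

theorem length_toList_restrictSub {n : ℕ} (x : Fin n → Bool) (S : Finset (Fin n)) :
    (restrictSub x S).toList.length = S.card := by
  simp [toList_restrictSub]

theorem toList_restrictSub_sublist {n : ℕ} (x : Fin n → Bool) {A B : Finset (Fin n)}
    (h : B ⊆ A) : (restrictSub x B).toList.Sublist (restrictSub x A).toList := by
  rw [toList_restrictSub, toList_restrictSub]
  refine List.Sublist.map x (List.sublist_of_subperm_of_pairwise (r := (· ≤ ·)) ?_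
    (B.pairwise_sort _) (A.pairwise_sort _))
  exact (B.sort_nodup _).subperm fun i hi => by simpa using h (by simpa using hi)

/-- A list containing every superstring of `z` (in the subsequence order) of length at most `N`. -/
def superlists : ℕ → List Bool → List (List Bool)
  | 0, [] => [[]]
  | 0, _ :: _ => []
  | N + 1, [] => [] :: ((superlists N []).map (List.cons true) ++
      (superlists N []).map (List.cons false))
  | N + 1, a :: z => (superlists N z).map (List.cons a) ++
      (superlists N (a :: z)).map (List.cons !a)

theorem mem_superlists {N : ℕ} {y z : List Bool} (hy : y.length ≤ N) (h : z.Sublist y) :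
    y ∈ superlists N z := by
  induction N generalizing y z with
  | zero =>
    obtain rfl := List.length_eq_zero_iff.1 (Nat.le_zero.1 hy)
    obtain rfl := List.sublist_nil.1 h
    simp [superlists]
  | succ N ih =>
    cases y with
    | nil =>
      obtain rfl := List.sublist_nil.1 h
      simp [superlists]
    | cons b y =>
      have hy' : y.length ≤ N := by simpa using hy
      cases z with
      | nil => cases b <;> simp [superlists, ih hy' (List.nil_sublist y)]
      | cons a z =>
        rcases eq_or_ne b a with rfl | hba
        · simp [superlists, ih hy' (List.cons_sublist_cons.1 h)]
        · have hz : (a :: z).Sublist y := by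
            cases h with
            | cons _ h => exact h
            | cons_cons _ h => exact absurd rfl hba
          have hb : b = !a := by cases a <;> cases b <;> simp_all
          simp [superlists, hb, ih hy' hz]

theorem sum_superlists_le {t : ℝ} (ht0 : 0 ≤ t) (ht1 : t ≤ 1) (N : ℕ) (z : List Bool) :
    (1 - t) ^ (z.length + 1) * ((superlists N z).map fun y => (t / 2) ^ y.length).sum ≤
      (t / 2) ^ z.length := by
  have h1 : 0 ≤ 1 - t := by linarith
  induction N generalizing z with
  | zero =>
    cases z with
    | nil => simpa [superlists] using ht0
    | cons a z => simp only [superlists, List.map_nil, List.sum_nil, mul_zero]; positivity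
  | succ N ih =>
    have hcons : ∀ (b : Bool) (L : List (List Bool)),
        ((L.map (List.cons b)).map fun y => (t / 2) ^ y.length).sum =
          t / 2 * (L.map fun y => (t / 2) ^ y.length).sum := by
      intro b L
      rw [← List.sum_map_mul_left, List.map_map]
      simp [Function.comp_def, pow_succ']
    cases z with
    | nil =>
      have := ih []
      simp only [superlists, List.map_cons, List.map_append, List.sum_cons, List.sum_append, hcons,
        List.length_nil, pow_zero, zero_add, pow_one] at this ⊢
      nlinarith
    | cons a z =>
      have hz := mul_le_mul_of_nonneg_left (ih z) (mul_nonneg h1 (div_nonneg ht0 zero_le_two))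
      have haz := mul_le_mul_of_nonneg_left (ih (a :: z)) (div_nonneg ht0 zero_le_two)
      have hp : 0 ≤ (t / 2) ^ (z.length + 1) := by positivity
      simp only [superlists, List.map_append, List.sum_append, hcons, List.length_cons] at *
      calc _ = (1 - t) * (t / 2) * ((1 - t) ^ (z.length + 1) *
              ((superlists N z).map fun y => (t / 2) ^ y.length).sum) +
            t / 2 * ((1 - t) ^ (z.length + 1 + 1) *
              ((superlists N (a :: z)).map fun y => (t / 2) ^ y.length).sum) := by ring
        _ ≤ _ := add_le_add hz haz
        _ = (1 - t / 2) * (t / 2) ^ (z.length + 1) := by ring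
        _ ≤ (t / 2) ^ (z.length + 1) := mul_le_of_le_one_left hp (by linarith)

theorem sum_sublists_le {t : ℝ} (ht0 : 0 ≤ t) (ht1 : t ≤ 1) (y : List Bool) :
    (y.sublists'.map fun z => (1 - t) ^ z.length * (t / 2) ^ (y.length - z.length)).sum ≤ 1 := by
  have h1 : 0 ≤ 1 - t := by linarith
  induction y with
  | nil => simp
  | cons a y ih =>
    have hkeep : (y.sublists'.map fun z => (1 - t) ^ z.length *
        (t / 2) ^ (y.length + 1 - z.length)).sum = t / 2 * (y.sublists'.map fun z =>
          (1 - t) ^ z.length * (t / 2) ^ (y.length - z.length)).sum := by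
      rw [← List.sum_map_mul_left]
      refine congrArg List.sum (List.map_congr_left fun z hz => ?_)
      rw [Nat.succ_sub (List.mem_sublists'.1 hz).length_le, pow_succ]
      ring
    have hcons : ((y.sublists'.map (List.cons a)).map fun z => (1 - t) ^ z.length *
        (t / 2) ^ (y.length + 1 - z.length)).sum = (1 - t) * (y.sublists'.map fun z =>
          (1 - t) ^ z.length * (t / 2) ^ (y.length - z.length)).sum := by
      rw [← List.sum_map_mul_left, List.map_map]
      refine congrArg List.sum (List.map_congr_left fun z hz => ?_)
      simp only [Function.comp_apply, List.length_cons, Nat.add_sub_add_right]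
      ring
    rw [List.sublists'_cons, List.map_append, List.sum_append, List.length_cons, hkeep, hcons]
    nlinarith [div_nonneg ht0 zero_le_two]

/-- A sum over outputs satisfying `P` is at most the sum over any list containing them. -/
theorem DelOut.sum_ite_le_sum_map {n : ℕ} (P : DelOut n → Prop) [DecidablePred P]
    {w : List Bool → ℝ} (hw : ∀ l, 0 ≤ w l) {L : List (List Bool)}
    (hL : ∀ y : DelOut n, P y → y.toList ∈ L) :
    ∑ y : DelOut n, (if P y then w y.toList else 0) ≤ (L.map w).sum := by
  calc ∑ y : DelOut n, (if P y then w y.toList else 0)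
      = ∑ l ∈ (Finset.univ.filter P).image DelOut.toList, w l := by
        rw [Finset.sum_image fun _ _ _ _ h => DelOut.toList_injective h, Finset.sum_filter]
    _ ≤ ∑ l ∈ L.toFinset, w l := by
        refine Finset.sum_le_sum_of_subset_of_nonneg (fun l hl => ?_) fun l _ _ => hw l
        obtain ⟨y, hy, rfl⟩ := Finset.mem_image.1 hl
        exact List.mem_toFinset.2 (hL y (Finset.mem_filter.1 hy).2)
    _ = (L.dedup.map w).sum := by
        rw [← List.sum_toFinset _ L.nodup_dedup]
        exact Finset.sum_congr (by ext; simp) fun _ _ => rfl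
    _ ≤ (L.map w).sum := by
        refine ((List.dedup_sublist L).map w).sum_le_sum fun a ha => ?_
        obtain ⟨l, _, rfl⟩ := List.mem_map.1 ha
        exact hw l

/-- Weight attached to a pair of a string `y` and a subsequence `z` of `y`. It is a
subprobability in each argument. -/
def subseqWeight {n : ℕ} (t : ℝ) (y z : DelOut n) : ℝ :=
  if z.toList.Sublist y.toList then
    (1 - t) ^ (z.toList.length + 1) * (t / 2) ^ (y.toList.length - z.toList.length) else 0

theorem subseqWeight_nonneg {n : ℕ} {t : ℝ} (ht0 : 0 ≤ t) (ht1 : t ≤ 1) (y z : DelOut n) :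
    0 ≤ subseqWeight t y z := by
  have h1 : 0 ≤ 1 - t := by linarith
  rw [subseqWeight]
  split_ifs <;> positivity

theorem sum_subseqWeight_left_le {n : ℕ} {t : ℝ} (ht0 : 0 < t) (ht1 : t ≤ 1) (z : DelOut n) :
    ∑ y, subseqWeight t y z ≤ 1 := by
  have h1 : 0 ≤ 1 - t := by linarith
  have hpos : 0 < (t / 2) ^ z.toList.length := by positivity
  have hsum := DelOut.sum_ite_le_sum_map (fun y : DelOut n => z.toList.Sublist y.toList)
    (w := fun l => (t / 2) ^ l.length) (fun l => by positivity)
    fun y hy => mem_superlists y.length_toList_le hy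
  have hmul := (mul_le_mul_of_nonneg_left hsum (pow_nonneg h1 (z.toList.length + 1))).trans
    (sum_superlists_le ht0.le ht1 n z.toList)
  refine le_of_mul_le_mul_right ((le_of_eq ?_).trans (hmul.trans_eq (one_mul _).symm)) hpos
  rw [Finset.sum_mul, Finset.mul_sum]
  refine Finset.sum_congr rfl fun y _ => ?_
  rw [subseqWeight]
  split_ifs with h
  · rw [mul_assoc, ← pow_add, Nat.sub_add_cancel h.length_le]
  · simp

theorem sum_subseqWeight_right_le {n : ℕ} {t : ℝ} (ht0 : 0 ≤ t) (ht1 : t ≤ 1) (y : DelOut n) :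
    ∑ z, subseqWeight t y z ≤ 1 := by
  have h1 : 0 ≤ 1 - t := by linarith
  calc ∑ z, subseqWeight t y z
      ≤ ∑ z : DelOut n, if z.toList.Sublist y.toList then (1 - t) ^ z.toList.length *
          (t / 2) ^ (y.toList.length - z.toList.length) else 0 := by
        refine Finset.sum_le_sum fun z _ => ?_
        rw [subseqWeight]
        split_ifs
        · exact mul_le_mul_of_nonneg_right
            (pow_le_pow_of_le_one h1 (by linarith) (Nat.le_succ _)) (by positivity)
        · exact le_rfl
    _ ≤ _ := DelOut.sum_ite_le_sum_map (fun z : DelOut n => z.toList.Sublist y.toList)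
        (w := fun l => (1 - t) ^ l.length * (t / 2) ^ (y.toList.length - l.length))
        (fun l => by positivity) fun z hz => List.mem_sublists'.2 hz
    _ ≤ 1 := sum_sublists_le ht0 ht1 y.toList

theorem delW_nonneg {n : ℕ} {d : ℝ} (hd : d ∈ Set.Icc (0 : ℝ) 1) (x : Fin n → Bool)
    (y : DelOut n) : 0 ≤ delW d x y := by
  have h0 := hd.1
  have h1 : 0 ≤ 1 - d := sub_nonneg.2 hd.2
  refine Finset.sum_nonneg fun S _ => ?_
  split_ifs <;> positivity

theorem sum_delW {n : ℕ} (d : ℝ) (x : Fin n → Bool) : ∑ y, delW d x y = 1 := by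
  simp only [delW]
  rw [Finset.sum_comm]
  simp only [Finset.sum_ite_eq, Finset.mem_univ, if_true]
  simpa using Fin.sum_pow_mul_eq_add_pow (n := n) (1 - d) d

theorem sum_card_mul_pow {n : ℕ} (d : ℝ) :
    ∑ S : Finset (Fin n), (S.card : ℝ) * ((1 - d) ^ S.card * d ^ (n - S.card)) = n * (1 - d) := by
  have h := congrArg (Polynomial.eval (1 - d)) (bernsteinPolynomial.sum_smul ℝ n)
  have hs := Finset.sum_powerset_apply_card
    (fun m => (m : ℝ) * ((1 - d) ^ m * d ^ (n - m))) (x := (Finset.univ : Finset (Fin n)))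
  rw [Finset.powerset_univ, Finset.card_univ, Fintype.card_fin] at hs
  rw [hs]
  simp only [Polynomial.eval_finsetSum, nsmul_eq_mul, Polynomial.eval_mul,
    Polynomial.eval_natCast, Polynomial.eval_X, bernsteinPolynomial, Polynomial.eval_pow,
    Polynomial.eval_sub, Polynomial.eval_one, sub_sub_cancel] at h
  rw [← h]
  refine Finset.sum_congr rfl fun m _ => ?_
  rw [nsmul_eq_mul]
  ring

/-- Joint law of the sets `A ⊇ B` of positions kept under deletion probabilities `d₁ ≤ d₂` in the
monotone coupling. -/
def keepWeight {n : ℕ} (d₁ d₂ : ℝ) (A B : Finset (Fin n)) : ℝ :=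
  if B ⊆ A then (1 - d₂) ^ B.card * (d₂ - d₁) ^ (A.card - B.card) * d₁ ^ (n - A.card) else 0

theorem keepWeight_nonneg {n : ℕ} {d₁ d₂ : ℝ} (h₁ : 0 ≤ d₁) (h : d₁ ≤ d₂) (h₂ : d₂ ≤ 1)
    (A B : Finset (Fin n)) : 0 ≤ keepWeight d₁ d₂ A B := by
  have := sub_nonneg.2 h
  have := sub_nonneg.2 h₂
  rw [keepWeight]
  split_ifs <;> positivity

theorem sum_keepWeight_right {n : ℕ} (d₁ d₂ : ℝ) (A : Finset (Fin n)) :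
    ∑ B, keepWeight d₁ d₂ A B = (1 - d₁) ^ A.card * d₁ ^ (n - A.card) := by
  have hA : Finset.univ.filter (· ⊆ A) = A.powerset := by ext; simp
  simp only [keepWeight]
  rw [← Finset.sum_filter, hA, ← Finset.sum_mul, Finset.sum_pow_mul_eq_add_pow]
  ring

theorem sum_keepWeight_left {n : ℕ} (d₁ d₂ : ℝ) (B : Finset (Fin n)) :
    ∑ A, keepWeight d₁ d₂ A B = (1 - d₂) ^ B.card * d₂ ^ (n - B.card) := by
  have hB : Finset.univ.filter (· ⊆ Bᶜ) = Bᶜ.powerset := by ext; simp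
  have hn : Bᶜ.card = n - B.card := by simp [Finset.card_compl]
  calc ∑ A, keepWeight d₁ d₂ A B = ∑ D, keepWeight d₁ d₂ Dᶜ B :=
        (Equiv.sum_comp (compl_involutive.toPerm (α := Finset (Fin n)) compl) _).symm
    _ = ∑ D, if D ⊆ Bᶜ then
          (1 - d₂) ^ B.card * (d₁ ^ D.card * (d₂ - d₁) ^ (Bᶜ.card - D.card)) else 0 := by
        refine Finset.sum_congr rfl fun D _ => ?_
        have hD : D.card ≤ n := by simpa using D.card_le_univ
        have h1 : n - D.card - B.card = n - B.card - D.card := by omega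
        have h2 : n - (n - D.card) = D.card := by omega
        simp only [keepWeight, Finset.subset_compl_comm (s := B), Finset.card_compl,
          Fintype.card_fin, h1, h2]
        split_ifs <;> ring
    _ = (1 - d₂) ^ B.card * d₂ ^ (n - B.card) := by
        rw [← Finset.sum_filter, hB, ← Finset.mul_sum, Finset.sum_pow_mul_eq_add_pow, hn]
        ring

/-- Joint law of the outputs of the two deletion channels in the monotone coupling. -/
def delCoupling {n : ℕ} (d₁ d₂ : ℝ) (x : Fin n → Bool) (y z : DelOut n) : ℝ :=
  ∑ A : Finset (Fin n), ∑ B : Finset (Fin n),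
    if restrictSub x A = y then if restrictSub x B = z then keepWeight d₁ d₂ A B else 0 else 0

theorem delCoupling_nonneg {n : ℕ} {d₁ d₂ : ℝ} (h₁ : 0 ≤ d₁) (h : d₁ ≤ d₂) (h₂ : d₂ ≤ 1)
    (x : Fin n → Bool) (y z : DelOut n) : 0 ≤ delCoupling d₁ d₂ x y z := by
  refine Finset.sum_nonneg fun A _ => Finset.sum_nonneg fun B _ => ?_
  have := keepWeight_nonneg h₁ h h₂ A B
  split_ifs <;> positivity

theorem sum_delCoupling_mul {n : ℕ} (d₁ d₂ : ℝ) (x : Fin n → Bool)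
    (g : DelOut n → DelOut n → ℝ) :
    ∑ y, ∑ z, delCoupling d₁ d₂ x y z * g y z =
      ∑ A, ∑ B, keepWeight d₁ d₂ A B * g (restrictSub x A) (restrictSub x B) := by
  calc ∑ y, ∑ z, delCoupling d₁ d₂ x y z * g y z
      = ∑ y, ∑ z, ∑ A, ∑ B, (if restrictSub x A = y then if restrictSub x B = z then
          keepWeight d₁ d₂ A B * g y z else 0 else 0) := by
        simp only [delCoupling, Finset.sum_mul, ite_mul, zero_mul]
    _ = ∑ A, ∑ B, ∑ y, ∑ z, (if restrictSub x A = y then if restrictSub x B = z then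
          keepWeight d₁ d₂ A B * g y z else 0 else 0) := by
        simp only [Finset.sum_comm (s := (Finset.univ : Finset (DelOut n)))
          (t := (Finset.univ : Finset (Finset (Fin n))))]
    _ = _ := by
        refine Finset.sum_congr rfl fun A _ => Finset.sum_congr rfl fun B _ => ?_
        rw [Finset.sum_eq_single (restrictSub x A) (fun y _ hy => by simp [hy.symm]) (by simp)]
        simp

theorem sum_delCoupling_right {n : ℕ} (d₁ d₂ : ℝ) (x : Fin n → Bool) (y : DelOut n) :
    ∑ z, delCoupling d₁ d₂ x y z = delW d₁ x y := by
  simp only [delCoupling, delW]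
  rw [Finset.sum_comm]
  refine Finset.sum_congr rfl fun A _ => ?_
  rw [Finset.sum_comm, ← sum_keepWeight_right d₁ d₂ A]
  split_ifs <;> simp

theorem sum_delCoupling_left {n : ℕ} (d₁ d₂ : ℝ) (x : Fin n → Bool) (z : DelOut n) :
    ∑ y, delCoupling d₁ d₂ x y z = delW d₂ x z := by
  simp only [delCoupling, delW]
  rw [Finset.sum_comm]
  simp only [Finset.sum_comm (s := (Finset.univ : Finset (DelOut n)))
    (t := (Finset.univ : Finset (Finset (Fin n)))), Finset.sum_ite_eq, Finset.mem_univ, if_true]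
  rw [Finset.sum_comm]
  refine Finset.sum_congr rfl fun B _ => ?_
  rw [← sum_keepWeight_left d₁ d₂ B]
  split_ifs <;> simp

theorem subseqWeight_ne_zero_of_delCoupling {n : ℕ} {d₁ d₂ t : ℝ} (ht0 : 0 < t) (ht1 : t < 1)
    {x : Fin n → Bool} {y z : DelOut n} (h : delCoupling d₁ d₂ x y z ≠ 0) :
    subseqWeight t y z ≠ 0 := by
  obtain ⟨A, _, hA⟩ := Finset.exists_ne_zero_of_sum_ne_zero h
  obtain ⟨B, _, hB⟩ := Finset.exists_ne_zero_of_sum_ne_zero hA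
  simp only [keepWeight, ne_eq, ite_eq_right_iff, Classical.not_imp] at hB
  obtain ⟨rfl, rfl, hBA, _⟩ := hB
  have h1 : 0 < 1 - t := by linarith
  rw [subseqWeight, if_pos (toList_restrictSub_sublist x hBA)]
  positivity

theorem sum_delCoupling_mul_neg_logb_le {n : ℕ} {d₁ d₂ t : ℝ} (h₁ : 0 ≤ d₁) (h : d₁ ≤ d₂)
    (h₂ : d₂ ≤ 1) (ht0 : 0 < t) (ht1 : t < 1) (x : Fin n → Bool) :
    ∑ y, ∑ z, delCoupling d₁ d₂ x y z * -Real.logb 2 (subseqWeight t y z) ≤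
      (n + 1) * -Real.logb 2 (1 - t) + n * (d₂ - d₁) * -Real.logb 2 (t / 2) := by
  have h1 : 0 < 1 - t := by linarith
  have ha : 0 ≤ -Real.logb 2 (1 - t) :=
    neg_nonneg.2 (Real.logb_nonpos one_lt_two h1.le (by linarith))
  set a := -Real.logb 2 (1 - t)
  set b := -Real.logb 2 (t / 2)
  have hterm : ∀ A B : Finset (Fin n), keepWeight d₁ d₂ A B *
      -Real.logb 2 (subseqWeight t (restrictSub x A) (restrictSub x B)) ≤
      keepWeight d₁ d₂ A B * ((n + 1) * a) +
        b * (A.card * keepWeight d₁ d₂ A B - B.card * keepWeight d₁ d₂ A B) := by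
    intro A B
    by_cases hBA : B ⊆ A
    · have hB : (B.card : ℝ) ≤ n := by exact_mod_cast by simpa using B.card_le_univ
      have hlog : -Real.logb 2 (subseqWeight t (restrictSub x A) (restrictSub x B)) ≤
          (n + 1) * a + b * (A.card - B.card) := by
        rw [subseqWeight, if_pos (toList_restrictSub_sublist x hBA), length_toList_restrictSub,
          length_toList_restrictSub, Real.logb_mul (by positivity) (by positivity),
          Real.logb_pow, Real.logb_pow, Nat.cast_sub (Finset.card_le_card hBA)]
        push_cast
        nlinarith
      have := mul_le_mul_of_nonneg_left hlog (keepWeight_nonneg h₁ h h₂ A B)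
      linarith
    · simp [keepWeight, hBA]
  have htotal : ∑ A : Finset (Fin n), ∑ B, keepWeight d₁ d₂ A B = 1 := by
    simp only [sum_keepWeight_right]
    simpa using Fin.sum_pow_mul_eq_add_pow (n := n) (1 - d₁) d₁
  have hcardA : ∑ A : Finset (Fin n), ∑ B, A.card * keepWeight d₁ d₂ A B = n * (1 - d₁) := by
    simp only [← Finset.mul_sum, sum_keepWeight_right, sum_card_mul_pow]
  have hcardB : ∑ A : Finset (Fin n), ∑ B, B.card * keepWeight d₁ d₂ A B = n * (1 - d₂) := by
    rw [Finset.sum_comm]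
    simp only [← Finset.mul_sum, sum_keepWeight_left, sum_card_mul_pow]
  rw [sum_delCoupling_mul]
  refine (Finset.sum_le_sum fun A _ => Finset.sum_le_sum fun B _ => hterm A B).trans_eq ?_
  simp only [Finset.sum_add_distrib, Finset.sum_sub_distrib, ← Finset.mul_sum, ← Finset.sum_mul]
  simp only [← Finset.mul_sum] at hcardA hcardB
  rw [htotal, hcardA, hcardB]
  ring

theorem bddAbove_range_mutualInfo_delW {n : ℕ} {d : ℝ} (hd : d ∈ Set.Icc (0 : ℝ) 1) :
    BddAbove (Set.range fun p : {p : (Fin n → Bool) → ℝ // IsDist p} =>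
      mutualInfo p.1 (delW d)) := by
  refine ⟨Fintype.card (Fin n → Bool) / Real.log 2, ?_⟩
  rintro _ ⟨p, rfl⟩
  exact mutualInfo_le_card_div_log_two p.2.1 (delW_nonneg hd) (sum_delW d)

theorem Cn_nonneg (n : ℕ) (d : ℝ) : 0 ≤ Cn n d :=
  mul_nonneg (by positivity) (Real.iSup_nonneg'
    ⟨⟨_, isDist_pi_single fun _ => false⟩, (mutualInfo_pi_single _ _).ge⟩)

theorem Cn_le_add_of_mutualInfo_le {n : ℕ} (hn : 1 ≤ n) {d d' K : ℝ}
    (hd' : d' ∈ Set.Icc (0 : ℝ) 1)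
    (h : ∀ p : (Fin n → Bool) → ℝ, IsDist p →
      mutualInfo p (delW d) ≤ mutualInfo p (delW d') + n * K) :
    Cn n d ≤ Cn n d' + K := by
  have : Nonempty {p : (Fin n → Bool) → ℝ // IsDist p} := ⟨⟨_, isDist_pi_single fun _ => false⟩⟩
  have hn' : (0 : ℝ) < n := by exact_mod_cast hn
  have hsup : (⨆ p : {p : (Fin n → Bool) → ℝ // IsDist p}, mutualInfo p.1 (delW d)) ≤
      (⨆ p : {p : (Fin n → Bool) → ℝ // IsDist p}, mutualInfo p.1 (delW d')) + n * K :=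
    ciSup_le fun p => (h p.1 p.2).trans
      (add_le_add_left (le_ciSup (bddAbove_range_mutualInfo_delW hd') p) _)
  have := mul_le_mul_of_nonneg_left hsup (one_div_pos.2 hn').le
  refine this.trans_eq ?_
  rw [Cn, mul_add, ← mul_assoc, one_div_mul_cancel hn'.ne', one_mul]

theorem C_le_add_of_Cn_le {d d' K : ℝ} (h : ∀ n : ℕ, 1 ≤ n → Cn n d ≤ Cn n d' + K) :
    C d ≤ C d' + K := by
  have : Nonempty {m : ℕ // 1 ≤ m} := ⟨⟨1, le_rfl⟩⟩
  rw [← sub_le_iff_le_add]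
  refine le_ciInf fun n => sub_le_iff_le_add.2 (le_trans ?_ (h n n.2))
  exact ciInf_le ⟨0, by rintro _ ⟨m, rfl⟩; exact Cn_nonneg m d⟩ n

theorem abs_C_sub_C_le {d₁ d₂ t : ℝ} (h₁ : 0 ≤ d₁) (h : d₁ ≤ d₂) (h₂ : d₂ ≤ 1)
    (ht0 : 0 < t) (ht1 : t < 1) :
    |C d₁ - C d₂| ≤ 2 * -Real.logb 2 (1 - t) + (d₂ - d₁) * -Real.logb 2 (t / 2) := by
  set K := 2 * -Real.logb 2 (1 - t) + (d₂ - d₁) * -Real.logb 2 (t / 2)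
  have hK : ∀ (n : ℕ), 1 ≤ n → ∀ x : Fin n → Bool,
      ∑ y, ∑ z, delCoupling d₁ d₂ x y z * -Real.logb 2 (subseqWeight t y z) ≤ n * K := by
    intro n hn x
    refine (sum_delCoupling_mul_neg_logb_le h₁ h h₂ ht0 ht1 x).trans ?_
    have ha : 0 ≤ -Real.logb 2 (1 - t) :=
      neg_nonneg.2 (Real.logb_nonpos one_lt_two (by linarith) (by linarith))
    have hn' : (1 : ℝ) ≤ n := by exact_mod_cast hn
    nlinarith
  have hJ := fun n => delCoupling_nonneg (n := n) h₁ h h₂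
  have hf := fun n => subseqWeight_nonneg (n := n) ht0.le ht1.le
  have h12 : C d₁ ≤ C d₂ + K := C_le_add_of_Cn_le fun n hn =>
    Cn_le_add_of_mutualInfo_le hn ⟨h₁.trans h, h₂⟩ fun p hp =>
      mutualInfo_le_add_of_coupling hp (hJ n) (sum_delCoupling_right d₁ d₂)
        (sum_delCoupling_left d₁ d₂) (sum_delW d₂) (hf n)
        (sum_subseqWeight_left_le ht0 ht1.le)
        (fun _ _ _ => subseqWeight_ne_zero_of_delCoupling ht0 ht1) (hK n hn)
  have h21 : C d₂ ≤ C d₁ + K := C_le_add_of_Cn_le fun n hn =>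
    Cn_le_add_of_mutualInfo_le hn ⟨h₁, h.trans h₂⟩ fun p hp =>
      mutualInfo_le_add_of_coupling (J := fun x z y => delCoupling d₁ d₂ x y z)
        (f := fun z y => subseqWeight t y z) hp (fun x z y => hJ n x y z)
        (sum_delCoupling_left d₁ d₂) (sum_delCoupling_right d₁ d₂) (sum_delW d₁)
        (fun z y => hf n y z) (sum_subseqWeight_right_le ht0.le ht1.le)
        (fun _ _ _ => subseqWeight_ne_zero_of_delCoupling ht0 ht1)
        (fun x => Finset.sum_comm.trans_le (hK n hn x))
  rw [abs_le]
  constructor <;> linarith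

/-- `C` is uniformly continuous on `[0,1]`: for every `β > 0` there is an
`α > 0` such that for all `d₁, d₂ ∈ [0,1]`, `|d₁ − d₂| < α` implies `|C(d₁) − C(d₂)| < β`. -/
theorem C_uniformly_continuous :
    ∀ β : ℝ, 0 < β → ∃ α : ℝ, 0 < α ∧
      ∀ d₁ ∈ Set.Icc (0 : ℝ) 1, ∀ d₂ ∈ Set.Icc (0 : ℝ) 1,
        |d₁ - d₂| < α → |C d₁ - C d₂| < β := by
  intro β hβ
  obtain ⟨s, hs0, hs1, hs⟩ : ∃ s : ℝ, 0 < s ∧ s < 1 ∧ Real.logb 2 s = -(β / 8) :=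
    ⟨2 ^ (-(β / 8)), by positivity,
      Real.rpow_lt_one_of_one_lt_of_neg one_lt_two (by linarith),
      Real.logb_rpow two_pos (by norm_num)⟩
  have hb : 0 < -Real.logb 2 ((1 - s) / 2) :=
    neg_pos.2 (Real.logb_neg one_lt_two (by linarith) (by linarith))
  set b := -Real.logb 2 ((1 - s) / 2) with hb'
  have key : ∀ d₁ ∈ Set.Icc (0 : ℝ) 1, ∀ d₂ ∈ Set.Icc (0 : ℝ) 1, d₁ ≤ d₂ →
      |d₁ - d₂| < β / (4 * b) → |C d₁ - C d₂| < β := by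
    intro d₁ h₁ d₂ h₂ h hlt
    have hC := abs_C_sub_C_le h₁.1 h h₂.2 (sub_pos.2 hs1) (sub_lt_self 1 hs0)
    rw [sub_sub_cancel, hs, ← hb'] at hC
    rw [abs_sub_comm, abs_of_nonneg (sub_nonneg.2 h), lt_div_iff₀ (by positivity)] at hlt
    linarith
  refine ⟨β / (4 * b), by positivity, fun d₁ h₁ d₂ h₂ hlt => ?_⟩
  rcases le_total d₁ d₂ with h | h
  · exact key d₁ h₁ d₂ h₂ h hlt
  · rw [abs_sub_comm] at hlt ⊢
    exact key d₂ h₂ d₁ h₁ h hlt
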